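/- arXiv:0904.1413 — 3 statements merged into one kernel-verified Lean document; each statement's English description precedes it below -/
import Mathlib

section
/- Let P be the transition matrix of a finite absorbing Markov chain with transient states 1,…,r and absorbing states r+1,…,s, and let Q be the r×r block of P recording transitions among transient states. Then the matrix I − Q is invertible (over ℝ). -/
/-- A convex combination of reals bounded by `M` reaches `M` only if every value of positive
weight equals `M`. -/
theorem eq_of_le_sum_mul_of_pos {ι : Type*} [Fintype ι] {p a : ι → ℝ} {M : ℝ}
    (hp : ∀ j, 0 ≤ p j) (hsum : ∑ j, p j = 1) (ha : ∀ j, a j ≤ M)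
    (hM : M ≤ ∑ j, p j * a j) {j : ι} (hj : 0 < p j) : a j = M := by
  have hnonneg : ∀ k ∈ Finset.univ, 0 ≤ p k * (M - a k) := fun k _ =>
    mul_nonneg (hp k) (sub_nonneg.2 (ha k))
  have htotal : ∑ k, p k * (M - a k) = M - ∑ k, p k * a k := by
    simp only [mul_sub, Finset.sum_sub_distrib, ← Finset.sum_mul, hsum, one_mul]
  have hle := Finset.single_le_sum hnonneg (Finset.mem_univ j)
  nlinarith [ha j]

/-- Maximum principle for a stochastic matrix: a function that is harmonic off its zero set
vanishes if its zero set can be reached from every state. -/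
theorem eq_zero_of_harmonic_of_reachable {ι : Type*} [Fintype ι] {P : Matrix ι ι ℝ}
    (hnonneg : ∀ i j, 0 ≤ P i j) (hrow : ∀ i, ∑ j, P i j = 1) {w : ι → ℝ}
    (hharm : ∀ i, w i ≠ 0 → w i = ∑ j, P i j * w j)
    (hreach : ∀ i, w i ≠ 0 → ∃ (m : ℕ) (f : ℕ → ι), f 0 = i ∧
      (∀ k < m, 0 < P (f k) (f (k + 1))) ∧ w (f m) = 0) : w = 0 := by
  by_contra hw
  obtain ⟨i₀, hi₀⟩ := Function.ne_iff.1 hw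
  have : Nonempty ι := ⟨i₀⟩
  obtain ⟨i, hmax⟩ := Finite.exists_max fun j => |w j|
  have hpos : 0 < |w i| := (abs_pos.2 hi₀).trans_le (hmax i₀)
  obtain ⟨m, f, hf0, hstep, hfm⟩ := hreach i (abs_pos.1 hpos)
  have hpath : ∀ k ≤ m, |w (f k)| = |w i| := by
    intro k
    induction k with
    | zero => simp [hf0]
    | succ k ih =>
      intro hk
      have hwk := ih (Nat.le_of_succ_le hk)
      refine eq_of_le_sum_mul_of_pos (p := P (f k)) (a := fun j => |w j|)
        (hnonneg _) (hrow _) hmax ?_ (hstep k hk)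
      calc |w i| = |∑ j, P (f k) j * w j| := by
            rw [← hharm _ (abs_pos.1 (hwk ▸ hpos)), hwk]
        _ ≤ ∑ j, |P (f k) j * w j| := Finset.abs_sum_le_sum_abs _ _
        _ = ∑ j, P (f k) j * |w j| := by
            simp only [abs_mul, abs_of_nonneg (hnonneg _ _)]
  have hend := hpath m le_rfl
  rw [hfm, abs_zero] at hend
  exact hpos.ne hend


/-- For the transition matrix `P` of a finite absorbing Markov chain
with transient states `0, …, r-1` and absorbing states `r, …, s-1`, letting `Q` be the
transient-to-transient block of `P`, the matrix `I - Q` is invertible over `ℝ`. -/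
theorem engel_one_sub_Q_invertible
    (r s : ℕ) (hr : 1 ≤ r) (hrs : r < s)
    (P : Matrix (Fin s) (Fin s) ℝ)
    (hnonneg : ∀ i j, 0 ≤ P i j)
    (hrow : ∀ i, ∑ j, P i j = 1)
    (hdiag : ∀ j : Fin s, r ≤ (j : ℕ) → P j j = 1)
    (habsorbing : ∀ i : Fin s, (i : ℕ) < r →
      ∃ (m : ℕ) (f : ℕ → Fin s), f 0 = i ∧ (∀ k < m, 0 < P (f k) (f (k + 1))) ∧
        r ≤ ((f m : Fin s) : ℕ))
    (Q : Matrix (Fin r) (Fin r) ℝ)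
    (hQ : ∀ i j : Fin r, Q i j = P (Fin.castLE hrs.le i) (Fin.castLE hrs.le j)) :
    IsUnit (1 - Q) := by
  rw [Matrix.isUnit_iff_isUnit_det, isUnit_iff_ne_zero]
  intro hdet
  obtain ⟨v, hv0, hv⟩ := Matrix.exists_mulVec_eq_zero_iff.2 hdet
  rw [Matrix.sub_mulVec, Matrix.one_mulVec, sub_eq_zero] at hv
  let w : Fin s → ℝ := fun i => if h : (i : ℕ) < r then v ⟨i, h⟩ else 0
  have hwcast : ∀ i : Fin r, w (Fin.castLE hrs.le i) = v i := fun i => by simp [w]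
  have hwabs : ∀ i : Fin s, r ≤ (i : ℕ) → w i = 0 := fun i hi => by simp [w, hi]
  have htrans : ∀ i, w i ≠ 0 → (i : ℕ) < r := fun i hi =>
    not_le.1 fun h => hi (hwabs i h)
  have hw : w = 0 := by
    refine eq_zero_of_harmonic_of_reachable hnonneg hrow (fun i hi => ?_) fun i hi => ?_
    · obtain ⟨i, rfl⟩ : ∃ i' : Fin r, Fin.castLE hrs.le i' = i := ⟨⟨i, htrans i hi⟩, rfl⟩
      rw [hwcast, congrFun hv i]
      refine Fintype.sum_of_injective (Fin.castLE hrs.le) (Fin.castLE_injective hrs.le) _ _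
        (fun j hj => ?_) fun j => by rw [← hQ, hwcast]
      rw [hwabs j (not_lt.1 fun h => hj ⟨⟨j, h⟩, rfl⟩), mul_zero]
    · obtain ⟨m, f, hf0, hstep, hfm⟩ := habsorbing i (htrans i hi)
      exact ⟨m, f, hf0, hstep, hwabs _ hfm⟩
  exact hv0 (funext fun i => by rw [← hwcast, hw]; rfl)
end

section
/- Let Q be the transient block of the transition matrix of a finite absorbing Markov chain. Then the matrix powers Qⁿ converge entrywise to 0 as n → ∞. -/
/-- If a weighted average of values bounded by `M` equals `M`, then every value of positive
weight equals `M`. -/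
theorem eq_of_sum_mul_eq_of_le {ι : Type*} [Fintype ι] {p w : ι → ℝ} {M : ℝ}
    (hp : ∀ j, 0 ≤ p j) (hsum : ∑ j, p j = 1) (hw : ∀ j, w j ≤ M)
    (h : ∑ j, p j * w j = M) {j : ι} (hj : 0 < p j) : w j = M := by
  have hzero : ∑ k, p k * (M - w k) = 0 := by
    simp only [mul_sub, Finset.sum_sub_distrib, ← Finset.sum_mul, hsum, h]
    ring
  have hterm := (Finset.sum_eq_zero_iff_of_nonneg
    fun k _ => mul_nonneg (hp k) (sub_nonneg.2 (hw k))).1 hzero j (Finset.mem_univ j)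
  rcases mul_eq_zero.1 hterm with h0 | h0 <;> linarith

namespace Matrix

/-- The iterates on the constant vector `1` of a nonnegative matrix with row sums at most `1`
converge to a nonnegative fixed vector. -/
theorem exists_tendsto_pow_mulVec_one {κ : Type*} [Fintype κ] [DecidableEq κ] {Q : Matrix κ κ ℝ}
    (hQ : ∀ i j, 0 ≤ Q i j) (hrow : ∀ i, ∑ j, Q i j ≤ 1) :
    ∃ v : κ → ℝ, 0 ≤ v ∧ Q *ᵥ v = v ∧
      Filter.Tendsto (fun n : ℕ => Q ^ n *ᵥ 1) Filter.atTop (nhds v) := by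
  have hpos : ∀ (n : ℕ) (i : κ), 0 ≤ (Q ^ n *ᵥ 1) i := fun n i =>
    Finset.sum_nonneg fun j _ => mul_nonneg (pow_apply_nonneg hQ n i j) zero_le_one
  have hanti : ∀ i, Antitone fun n : ℕ => (Q ^ n *ᵥ 1) i := fun i =>
    antitone_nat_of_succ_le fun n => by
      rw [pow_succ, ← mulVec_mulVec]
      refine Finset.sum_le_sum fun j _ =>
        mul_le_mul_of_nonneg_left ?_ (pow_apply_nonneg hQ n i j)
      simpa [mulVec, dotProduct] using hrow j
  have hlim : Filter.Tendsto (fun n : ℕ => Q ^ n *ᵥ 1) Filter.atTop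
      (nhds fun i => ⨅ n : ℕ, (Q ^ n *ᵥ 1) i) :=
    tendsto_pi_nhds.2 fun i => tendsto_atTop_ciInf (hanti i)
      ⟨0, by rintro _ ⟨n, rfl⟩; exact hpos n i⟩
  refine ⟨_, fun i => le_ciInf fun n => hpos n i, ?_, hlim⟩
  have hmul : Continuous fun x : κ → ℝ => Q *ᵥ x := by fun_prop
  refine tendsto_nhds_unique ((hmul.tendsto _).comp hlim) ?_
  refine (hlim.comp (Filter.tendsto_add_atTop_nat 1)).congr fun n => ?_
  simp only [Function.comp_apply, mulVec_mulVec, pow_succ']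

/-- A nonnegative vector fixed by the block of a stochastic matrix indexed by the range of `e`
vanishes, if from every index in that range one can leave it along positive entries. -/
theorem eq_zero_of_submatrix_mulVec_eq {ι κ : Type*} [Fintype ι] [Fintype κ]
    {P : Matrix ι ι ℝ} (hnonneg : ∀ i j, 0 ≤ P i j) (hrow : ∀ i, ∑ j, P i j = 1)
    {e : κ → ι} (he : Function.Injective e)
    (hexit : ∀ i : κ, ∃ (m : ℕ) (f : ℕ → ι), f 0 = e i ∧
      (∀ k < m, 0 < P (f k) (f (k + 1))) ∧ f m ∉ Set.range e)
    {v : κ → ℝ} (hv : 0 ≤ v) (hfix : P.submatrix e e *ᵥ v = v) : v = 0 := by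
  rcases isEmpty_or_nonempty κ with _ | _
  · exact Subsingleton.elim _ _
  obtain ⟨i₀, hmax⟩ := Finite.exists_max v
  suffices h : v i₀ = 0 from funext fun i => le_antisymm ((hmax i).trans h.le) (hv i)
  by_contra hne
  let w : ι → ℝ := Function.extend e v 0
  have hw_range : ∀ i, w (e i) = v i := fun i => he.extend_apply v (0 : ι → ℝ) i
  have hw_out : ∀ x, x ∉ Set.range e → w x = 0 := fun x hx => Function.extend_apply' v (0 : ι → ℝ) x hx
  have hw_le : ∀ x, w x ≤ v i₀ := fun x => by
    by_cases hx : x ∈ Set.range e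
    · obtain ⟨i, rfl⟩ := hx
      exact (hw_range i).trans_le (hmax i)
    · exact (hw_out x hx).trans_le (hv i₀)
  have hharm : ∀ i, ∑ x, P (e i) x * w x = v i := fun i => by
    rw [← congrFun hfix i]
    refine (Fintype.sum_of_injective e he _ _ (fun x hx => ?_) fun j => ?_).symm
    · rw [hw_out x hx, mul_zero]
    · simp only [hw_range, submatrix_apply]
  obtain ⟨m, f, hf0, hfpos, hfm⟩ := hexit i₀
  have hpath : ∀ k ≤ m, w (f k) = v i₀ := fun k => by
    induction k with
    | zero => exact fun _ => by rw [hf0, hw_range]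
    | succ k ih =>
      intro hk
      have hwk := ih (Nat.le_of_succ_le hk)
      obtain ⟨i, hi⟩ : f k ∈ Set.range e := by
        by_contra hx
        exact hne (hwk.symm.trans (hw_out _ hx))
      refine eq_of_sum_mul_eq_of_le (hnonneg (f k)) (hrow (f k)) hw_le ?_ (hfpos k hk)
      rw [← hwk, ← hi, hharm, hw_range]
  exact hne ((hpath m le_rfl).symm.trans (hw_out _ hfm))

/-- The powers of a block of a stochastic matrix tend to zero entrywise, if from every index
of the block one can leave it along positive entries. -/
theorem tendsto_submatrix_pow_apply_zero {ι κ : Type*} [Fintype ι] [Fintype κ] [DecidableEq κ]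
    {P : Matrix ι ι ℝ} (hnonneg : ∀ i j, 0 ≤ P i j) (hrow : ∀ i, ∑ j, P i j = 1)
    {e : κ → ι} (he : Function.Injective e)
    (hexit : ∀ i : κ, ∃ (m : ℕ) (f : ℕ → ι), f 0 = e i ∧
      (∀ k < m, 0 < P (f k) (f (k + 1))) ∧ f m ∉ Set.range e) (i j : κ) :
    Filter.Tendsto (fun n : ℕ => (P.submatrix e e ^ n) i j) Filter.atTop (nhds 0) := by
  have hQ : ∀ i j, 0 ≤ P.submatrix e e i j := fun i j => hnonneg (e i) (e j)
  have hQrow : ∀ i, ∑ j, P.submatrix e e i j ≤ 1 := fun i => by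
    rw [← hrow (e i)]
    exact (Finset.sum_map Finset.univ ⟨e, he⟩ (P (e i))).symm.trans_le
      (Finset.sum_le_univ_sum_of_nonneg (hnonneg (e i)))
  obtain ⟨v, hv, hfix, hlim⟩ := exists_tendsto_pow_mulVec_one hQ hQrow
  obtain rfl := eq_zero_of_submatrix_mulVec_eq hnonneg hrow he hexit hv hfix
  refine squeeze_zero (fun n => pow_apply_nonneg hQ n i j) (fun n => ?_)
    (tendsto_pi_nhds.1 hlim i)
  simpa [mulVec, dotProduct] using Finset.single_le_sum
    (fun k _ => pow_apply_nonneg hQ n i k) (Finset.mem_univ j)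

end Matrix


/-- For the transient block `Q` of the transition matrix of a finite
absorbing Markov chain, the powers `Q ^ n` converge entrywise to `0` as `n → ∞`. -/
theorem engel_Q_pow_tendsto_zero
    (r s : ℕ) (hr : 1 ≤ r) (hrs : r < s)
    (P : Matrix (Fin s) (Fin s) ℝ)
    (hnonneg : ∀ i j, 0 ≤ P i j)
    (hrow : ∀ i, ∑ j, P i j = 1)
    (hdiag : ∀ j : Fin s, r ≤ (j : ℕ) → P j j = 1)
    (habsorbing : ∀ i : Fin s, (i : ℕ) < r →
      ∃ (m : ℕ) (f : ℕ → Fin s), f 0 = i ∧ (∀ k < m, 0 < P (f k) (f (k + 1))) ∧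
        r ≤ ((f m : Fin s) : ℕ))
    (Q : Matrix (Fin r) (Fin r) ℝ)
    (hQ : ∀ i j : Fin r, Q i j = P (Fin.castLE hrs.le i) (Fin.castLE hrs.le j)) :
    ∀ i j : Fin r,
      Filter.Tendsto (fun n : ℕ => (Q ^ n) i j) Filter.atTop (nhds 0) := by
  intro i j
  obtain rfl : Q = P.submatrix (Fin.castLE hrs.le) (Fin.castLE hrs.le) := Matrix.ext hQ
  refine Matrix.tendsto_submatrix_pow_apply_zero hnonneg hrow
    (Fin.castLE_injective hrs.le) (fun k => ?_) i j
  obtain ⟨m, f, hf0, hfpos, hfm⟩ := habsorbing (Fin.castLE hrs.le k) k.isLt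
  refine ⟨m, f, hf0, hfpos, ?_⟩
  rintro ⟨l, hl⟩
  rw [← hl] at hfm
  exact absurd l.isLt (not_lt.2 hfm)
end

section
/- Let P be the transition matrix of a finite absorbing Markov chain with transient block Q and transient-to-absorbing block R, and set B = (I − Q)⁻¹ R. Then for every transient state u and every absorbing state j, the entries (Pⁿ)_{u,j} converge as n → ∞ to B_{u,j}; that is, the probability of being absorbed in state j when starting from u equals B_{u,j}. -/
open Filter Topology

/-- Splitting a sum over `Fin s` into the indices below `r` and the indices from `r` on. -/
theorem Fin.sum_eq_sum_castLE_add_sum_subtype {M : Type*} [AddCommMonoid M] {r s : ℕ}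
    (h : r ≤ s) (f : Fin s → M) :
    ∑ k, f k = ∑ k : Fin r, f (Fin.castLE h k) + ∑ k : {k : Fin s // r ≤ (k : ℕ)}, f k := by
  refine Eq.trans ?_
    (Fintype.sum_sum_type fun x => f (Sum.elim (Fin.castLE h) Subtype.val x))
  symm
  refine Fintype.sum_bijective (Sum.elim (Fin.castLE h) Subtype.val) ⟨?_, fun k => ?_⟩ _ _
    fun _ => rfl
  · refine (Fin.castLE_injective h).sumElim Subtype.val_injective fun a b hab => ?_
    have hb := b.2
    rw [← hab, Fin.val_castLE] at hb
    exact absurd a.2 hb.not_gt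
  · by_cases hk : r ≤ (k : ℕ)
    · exact ⟨.inr ⟨k, hk⟩, rfl⟩
    · exact ⟨.inl ⟨k, not_le.mp hk⟩, rfl⟩

section Stochastic

variable {ι : Type*} [Fintype ι] {P : Matrix ι ι ℝ}

/-- A harmonic function that is maximal at `i` takes the same value at every successor of `i`. -/
theorem Matrix.eq_of_mulVec_eq_of_forall_le (hnonneg : ∀ i j, 0 ≤ P i j)
    (hrow : ∀ i, ∑ j, P i j = 1) {y : ι → ℝ} (hy : P.mulVec y = y) {i k : ι}
    (hmax : ∀ l, y l ≤ y i) (hik : 0 < P i k) : y k = y i := by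
  have hsum : ∑ l, P i l * (y i - y l) = 0 := by
    have hi : ∑ l, P i l * y l = y i := congrFun hy i
    simp_rw [mul_sub, Finset.sum_sub_distrib, ← Finset.sum_mul, hrow, hi, one_mul, sub_self]
  have hk := (Finset.sum_eq_zero_iff_of_nonneg fun l _ =>
    mul_nonneg (hnonneg i l) (sub_nonneg.mpr (hmax l))).mp hsum k (Finset.mem_univ k)
  linarith [(mul_eq_zero.mp hk).resolve_left hik.ne']

/-- Maximum principle: a harmonic function that is nonpositive on a set reachable from every
state is nonpositive. -/
theorem Matrix.nonpos_of_mulVec_eq (hnonneg : ∀ i j, 0 ≤ P i j)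
    (hrow : ∀ i, ∑ j, P i j = 1) {A : Set ι}
    (hreach : ∀ i, ∃ (m : ℕ) (f : ℕ → ι), f 0 = i ∧ (∀ k < m, 0 < P (f k) (f (k + 1))) ∧ f m ∈ A)
    {y : ι → ℝ} (hy : P.mulVec y = y) (hA : ∀ i ∈ A, y i ≤ 0) (i : ι) : y i ≤ 0 := by
  have : Nonempty ι := ⟨i⟩
  obtain ⟨i₀, hmax⟩ := Finite.exists_max y
  obtain ⟨m, f, hf₀, hf, hfm⟩ := hreach i₀
  have hpath : ∀ k ≤ m, y (f k) = y i₀ := by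
    intro k
    induction k with
    | zero => intro _; rw [hf₀]
    | succ k ih =>
      intro hk
      have hyk := ih (Nat.le_of_succ_le hk)
      exact (eq_of_mulVec_eq_of_forall_le hnonneg hrow hy (fun l => hyk ▸ hmax l)
        (hf k hk)).trans hyk
  exact (hmax i).trans (hpath m le_rfl ▸ hA _ hfm)

variable [DecidableEq ι]

/-- The probabilities of occupying an absorbing state after `n` steps converge as `n → ∞`. -/
theorem Matrix.exists_tendsto_pow_apply (hnonneg : ∀ i j, 0 ≤ P i j)
    (hrow : ∀ i, ∑ j, P i j = 1) {j : ι} (hj : P j j = 1) (i : ι) :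
    ∃ l, Tendsto (fun n : ℕ => (P ^ n) i j) atTop (𝓝 l) := by
  have hmem : ∀ n : ℕ, P ^ n ∈ rowStochastic ℝ ι := fun n =>
    pow_mem (mem_rowStochastic_iff_sum.mpr ⟨hnonneg, hrow⟩) n
  refine ⟨_, tendsto_atTop_ciSup (monotone_nat_of_le_succ fun n => ?_)
    ⟨1, Set.forall_mem_range.mpr fun n => le_one_of_mem_rowStochastic (hmem n)⟩⟩
  rw [pow_succ, mul_apply]
  calc (P ^ n) i j = (P ^ n) i j * P j j := by rw [hj, mul_one]
    _ ≤ _ := Finset.single_le_sum (f := fun k => (P ^ n) i k * P k j)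
      (fun k _ => mul_nonneg (nonneg_of_mem_rowStochastic (hmem n)) (hnonneg k j))
      (Finset.mem_univ j)

/-- Powers of a matrix with an absorbing row `i` keep this row. -/
theorem Matrix.pow_apply_of_row_eq_one {i : ι} (hi : P i = (1 : Matrix ι ι ℝ) i) (n : ℕ) :
    (P ^ n) i = (1 : Matrix ι ι ℝ) i := by
  induction n with
  | zero => rw [pow_zero]
  | succ n ih =>
    rw [pow_succ, mul_apply_eq_vecMul, ih, ← mul_apply_eq_vecMul, one_mul, hi]

end Stochastic


/-- For a finite absorbing Markov chain with transient block `Q` and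
transient-to-absorbing block `R`, setting `B = (I - Q)⁻¹ R`, the absorption
probabilities are given by `B`: for every transient state `u` and absorbing state `j`,
`(Pⁿ)_{u j} → B_{u j}` as `n → ∞`. -/
theorem engel_absorption_probabilities
    (r s : ℕ) (hr : 1 ≤ r) (hrs : r < s)
    (P : Matrix (Fin s) (Fin s) ℝ)
    (hnonneg : ∀ i j, 0 ≤ P i j)
    (hrow : ∀ i, ∑ j, P i j = 1)
    (hdiag : ∀ j : Fin s, r ≤ (j : ℕ) → P j j = 1)
    (habsrow : ∀ i j : Fin s, r ≤ (i : ℕ) → j ≠ i → P i j = 0)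
    (habsorbing : ∀ i : Fin s, (i : ℕ) < r →
      ∃ (m : ℕ) (f : ℕ → Fin s), f 0 = i ∧ (∀ k < m, 0 < P (f k) (f (k + 1))) ∧
        r ≤ ((f m : Fin s) : ℕ))
    (Q : Matrix (Fin r) (Fin r) ℝ)
    (hQ : ∀ i j : Fin r, Q i j = P (Fin.castLE hrs.le i) (Fin.castLE hrs.le j))
    (R : Matrix (Fin r) {j : Fin s // r ≤ (j : ℕ)} ℝ)
    (hR : ∀ (i : Fin r) (j : {j : Fin s // r ≤ (j : ℕ)}),
      R i j = P (Fin.castLE hrs.le i) j.1)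
    (B : Matrix (Fin r) {j : Fin s // r ≤ (j : ℕ)} ℝ)
    (hB : B = (1 - Q)⁻¹ * R) :
    ∀ (u : Fin r) (j : {j : Fin s // r ≤ (j : ℕ)}),
      Filter.Tendsto (fun n : ℕ => (P ^ n) (Fin.castLE hrs.le u) j.1)
        Filter.atTop (nhds (B u j)) := by
  intro u j
  have hrow_abs : ∀ i : Fin s, r ≤ (i : ℕ) → P i = (1 : Matrix (Fin s) (Fin s) ℝ) i := by
    intro i hi
    ext k
    by_cases hk : k = i
    · rw [hk, hdiag i hi, Matrix.one_apply_eq]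
    · rw [habsrow i k hi hk, Matrix.one_apply_ne' hk]
  have hreach : ∀ i : Fin s, ∃ (m : ℕ) (f : ℕ → Fin s), f 0 = i ∧
      (∀ k < m, 0 < P (f k) (f (k + 1))) ∧ f m ∈ {i : Fin s | r ≤ (i : ℕ)} := by
    intro i
    rcases lt_or_ge (i : ℕ) r with hi | hi
    · exact habsorbing i hi
    · exact ⟨0, fun _ => i, rfl, fun _ hk => absurd hk (Nat.not_lt_zero _), hi⟩
  have hunit : IsUnit (1 - Q) := by
    rw [← Matrix.mulVec_injective_iff_isUnit]
    refine (injective_iff_map_eq_zero (1 - Q).mulVecLin).mpr fun x hx => ?_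
    have hQx : Q.mulVec x = x := by
      rw [Matrix.mulVecLin_apply, Matrix.sub_mulVec, Matrix.one_mulVec] at hx
      exact (sub_eq_zero.mp hx).symm
    let y : Fin s → ℝ := fun k => if hk : (k : ℕ) < r then x ⟨k, hk⟩ else 0
    have hy_castLE : ∀ k : Fin r, y (Fin.castLE hrs.le k) = x k := fun k => dif_pos k.2
    have hy_abs : ∀ k : Fin s, r ≤ (k : ℕ) → y k = 0 := fun k hk => dif_neg hk.not_gt
    have hy : P.mulVec y = y := by
      ext i
      by_cases hi : r ≤ (i : ℕ)
      · change P i ⬝ᵥ y = y i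
        rw [hrow_abs i hi]
        exact congrFun (Matrix.one_mulVec y) i
      · obtain ⟨i, rfl⟩ : ∃ i' : Fin r, i = Fin.castLE hrs.le i' := ⟨⟨i, not_le.mp hi⟩, rfl⟩
        rw [hy_castLE, ← congrFun hQx i, Matrix.mulVec, dotProduct,
          Fin.sum_eq_sum_castLE_add_sum_subtype hrs.le]
        have habs : ∀ k : {k : Fin s // r ≤ (k : ℕ)}, y k = 0 := fun k => hy_abs k k.2
        simp [hy_castLE, ← hQ, habs, Matrix.mulVec, dotProduct]
    ext k
    rw [← hy_castLE k]
    refine le_antisymm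
      (Matrix.nonpos_of_mulVec_eq hnonneg hrow hreach hy (fun i hi => (hy_abs i hi).le) _) ?_
    have hneg := Matrix.nonpos_of_mulVec_eq hnonneg hrow hreach (y := -y)
      (by rw [Matrix.mulVec_neg, hy]) (fun i hi => by simp [hy_abs i hi]) (Fin.castLE hrs.le k)
    simpa using hneg
  choose L hL using fun i => Matrix.exists_tendsto_pow_apply hnonneg hrow (hdiag j.1 j.2) i
  have hL_abs : ∀ i : Fin s, r ≤ (i : ℕ) → L i = (1 : Matrix (Fin s) (Fin s) ℝ) i j.1 :=
    fun i hi => tendsto_nhds_unique (hL i)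
      (by simp_rw [Matrix.pow_apply_of_row_eq_one (hrow_abs i hi)]; exact tendsto_const_nhds)
  have hL_harm : ∀ i, L i = ∑ k, P i k * L k := fun i =>
    tendsto_nhds_unique ((tendsto_add_atTop_iff_nat 1).mpr (hL i)) (by
      simp_rw [pow_succ', Matrix.mul_apply]
      exact tendsto_finsetSum _ fun k _ => (hL k).const_mul _)
  have hsolve : (1 - Q).mulVec (fun k => L (Fin.castLE hrs.le k)) = fun k => R k j := by
    ext i
    have hi := hL_harm (Fin.castLE hrs.le i)
    rw [Fin.sum_eq_sum_castLE_add_sum_subtype hrs.le] at hi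
    have habs : ∑ k : {k : Fin s // r ≤ (k : ℕ)}, P (Fin.castLE hrs.le i) k * L k = R i j := by
      rw [Finset.sum_eq_single j, hL_abs j j.2, Matrix.one_apply_eq, mul_one, hR]
      · intro k _ hk
        rw [hL_abs k k.2, Matrix.one_apply_ne (Subtype.coe_injective.ne hk), mul_zero]
      · exact fun h => absurd (Finset.mem_univ j) h
    rw [habs] at hi
    simp_rw [← hQ] at hi
    rw [Matrix.sub_mulVec, Matrix.one_mulVec, Pi.sub_apply, Matrix.mulVec, dotProduct]
    linarith
  have hBL : B u j = L (Fin.castLE hrs.le u) := by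
    have hdet := (Matrix.isUnit_iff_isUnit_det _).mp hunit
    have hcol : (1 - Q)⁻¹.mulVec (fun k => R k j) = fun k => L (Fin.castLE hrs.le k) := by
      rw [← hsolve, Matrix.mulVec_mulVec, Matrix.nonsing_inv_mul _ hdet, Matrix.one_mulVec]
    rw [hB]
    exact congrFun hcol u
  rw [hBL]
  exact hL _
end
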